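/- Let s_n denote the number of dispositions of the staircase digraph S_n (i.e., the Euler zigzag numbers with s₀ = s₁ = 1). Then for all n ≥ 1, 2·s_{n+1} = ∑_{k=0}^{n} C(n,k) · s_k · s_{n−k}. -/

import Mathlib

/-- The counter `σ(G)` of a finite simple digraph given by the arc relation `A`. -/
noncomputable def digraphCounter {V : Type*} [Fintype V] (A : V → V → Prop) : ℕ :=
  Nat.card {f : V ≃ Fin (Fintype.card V) // ∀ u v, A u v → (f v : ℕ) < (f u : ℕ)}

/-- The arc relation of the staircase digraph `S_n` on vertices `v₁,…,v_n`
(here `0`-indexed): arcs `v₁→v₂, v₃→v₂, v₃→v₄, v₅→v₄, …`, i.e. each even-indexed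
(0-based) vertex points to its neighbours. -/
def staircaseArc (n : ℕ) : Fin n → Fin n → Prop :=
  fun a b => Even (a : ℕ) ∧ ((b : ℕ) = (a : ℕ) + 1 ∨ (b : ℕ) + 1 = (a : ℕ))

/-- The Euler zigzag numbers, realized as counters of staircase digraphs
(`s₀ = s₁ = 1, 1, 2, 5, 16, 61, …`). -/
noncomputable def zigzag (n : ℕ) : ℕ := digraphCounter (staircaseArc n)

open Classical in
noncomputable def zzL (R : ℕ → ℕ → Prop) (S : Finset ℕ) : Finset (List ℕ) :=
  S.toList.permutations.toFinset.filter (fun l => l.Pairwise (fun x y => ¬ R x y))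

noncomputable def zzC (R : ℕ → ℕ → Prop) (S : Finset ℕ) : ℕ := (zzL R S).card

lemma mem_zzL {R : ℕ → ℕ → Prop} {S : Finset ℕ} {l : List ℕ} :
    l ∈ zzL R S ↔ l.Nodup ∧ (∀ x, x ∈ l ↔ x ∈ S) ∧ l.Pairwise (fun x y => ¬ R x y) := by
  classical
  simp only [zzL, Finset.mem_filter, List.mem_toFinset, List.mem_permutations, ← and_assoc]
  refine and_congr_left fun _ => ?_
  constructor
  · intro h
    exact ⟨h.nodup_iff.2 S.nodup_toList, fun x => by rw [h.mem_iff]; simp⟩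
  · rintro ⟨h1, h2⟩
    exact (List.perm_ext_iff_of_nodup h1 S.nodup_toList).2 (fun x => by simp [h2])

lemma zzC_empty (R : ℕ → ℕ → Prop) : zzC R ∅ = 1 := by
  have : zzL R ∅ = {[]} := by
    ext l
    rw [mem_zzL]
    constructor
    · rintro ⟨_, h, _⟩
      simp [List.eq_nil_iff_forall_not_mem, h]
    · intro h
      simp at h
      simp [h]
  simp [zzC, this]

open Classical in
lemma zzC_rec (R : ℕ → ℕ → Prop) (S : Finset ℕ) (hS : S.Nonempty) :
    zzC R S = ∑ v ∈ S.filter (fun v => ∀ u ∈ S, u ≠ v → ¬ R v u), zzC R (S.erase v) := by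
  have : zzL R S = (S.filter (fun v => ∀ u ∈ S, u ≠ v → ¬ R v u)).biUnion
      (fun v => (zzL R (S.erase v)).image (List.cons v)) := by
    ext l
    simp only [Finset.mem_biUnion, Finset.mem_image, mem_zzL, Finset.mem_filter]
    constructor
    · rintro ⟨h1, h2, h3⟩
      cases l with
      | nil => obtain ⟨x, hx⟩ := hS; simpa using (h2 x).2 hx
      | cons v l =>
        rw [List.nodup_cons] at h1
        rw [List.pairwise_cons] at h3
        refine ⟨v, ⟨(h2 v).1 (by simp), ?_⟩, l, ⟨h1.2, ?_, h3.2⟩, rfl⟩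
        · intro u hu huv
          have := (h2 u).2 hu
          simp [huv] at this
          exact h3.1 u this
        · intro x
          rw [Finset.mem_erase, ← h2 x]
          constructor
          · intro hx
            exact ⟨fun h => h1.1 (h ▸ hx), by simp [hx]⟩
          · rintro ⟨h, h'⟩
            simpa [h] using h'
    · rintro ⟨v, ⟨hv, hR⟩, l, ⟨h1, h2, h3⟩, rfl⟩
      refine ⟨List.nodup_cons.2 ⟨fun h => by simpa using (h2 v).1 h, h1⟩, ?_,
        List.pairwise_cons.2 ⟨fun u hu => ?_, h3⟩⟩
      · intro x
        rw [List.mem_cons, h2 x, Finset.mem_erase]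
        by_cases h : x = v <;> simp [h, hv]
      · have := Finset.mem_erase.1 ((h2 u).1 hu)
        exact hR u this.2 this.1
  rw [zzC, this, Finset.card_biUnion]
  · refine Finset.sum_congr rfl fun v _ => ?_
    rw [Finset.card_image_of_injective _ (List.cons_injective)]
    rfl
  · intro v _ w _ hvw
    simp only [Function.onFun]
    rw [Finset.disjoint_left]
    intro l h1 h2
    simp only [Finset.mem_image] at h1 h2
    obtain ⟨a, _, rfl⟩ := h1
    obtain ⟨b, _, h⟩ := h2
    simp at h
    exact hvw h.1.symm

lemma zzC_union (R : ℕ → ℕ → Prop) (m : ℕ) : ∀ S T : Finset ℕ, S.card + T.card = m →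
    Disjoint S T → (∀ s ∈ S, ∀ t ∈ T, ¬ R s t ∧ ¬ R t s) →
    zzC R (S ∪ T) = (S.card + T.card).choose S.card * (zzC R S * zzC R T) := by
  classical
  induction m with
  | zero =>
    intro S T h _ _
    have h1 : S = ∅ := by rw [← Finset.card_eq_zero]; omega
    have h2 : T = ∅ := by rw [← Finset.card_eq_zero]; omega
    subst h1 h2
    simp [zzC_empty]
  | succ m ih =>
    intro S T h hd hR
    rcases S.eq_empty_or_nonempty with rfl | hS
    · simp [zzC_empty]
    rcases T.eq_empty_or_nonempty with rfl | hT
    · simp [zzC_empty]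
    have hd' := Finset.disjoint_left.1 hd
    rw [zzC_rec R (S ∪ T) (hS.mono Finset.subset_union_left), Finset.filter_union,
      Finset.sum_union (Finset.disjoint_filter_filter hd)]
    have e1 : S.filter (fun v => ∀ u ∈ S ∪ T, u ≠ v → ¬ R v u)
        = S.filter (fun v => ∀ u ∈ S, u ≠ v → ¬ R v u) := by
      refine Finset.filter_congr fun v hv => ?_
      constructor
      · intro h u hu
        exact h u (Finset.mem_union_left _ hu)
      · intro h u hu huv
        rcases Finset.mem_union.1 hu with hu | hu
        · exact h u hu huv
        · exact (hR v hv u hu).1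
    have e2 : T.filter (fun v => ∀ u ∈ S ∪ T, u ≠ v → ¬ R v u)
        = T.filter (fun v => ∀ u ∈ T, u ≠ v → ¬ R v u) := by
      refine Finset.filter_congr fun v hv => ?_
      constructor
      · intro h u hu
        exact h u (Finset.mem_union_right _ hu)
      · intro h u hu huv
        rcases Finset.mem_union.1 hu with hu | hu
        · exact (hR u hu v hv).2
        · exact h u hu huv
    have hSc := hS.card_pos
    have hTc := hT.card_pos
    have s1 : ∀ v ∈ S.filter (fun v => ∀ u ∈ S, u ≠ v → ¬ R v u),
        zzC R ((S ∪ T).erase v) = m.choose (S.card - 1) * zzC R T * zzC R (S.erase v) := by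
      intro v hv
      have hv := (Finset.mem_filter.1 hv).1
      have hc := Finset.card_erase_of_mem hv
      rw [Finset.erase_union_distrib, Finset.erase_eq_of_notMem (hd' hv),
        ih _ _ (by omega) (hd.mono_left (Finset.erase_subset _ _))
          (fun s hs t ht => hR s (Finset.mem_of_mem_erase hs) t ht), hc,
        show S.card - 1 + T.card = m by omega]
      ring
    have s2 : ∀ v ∈ T.filter (fun v => ∀ u ∈ T, u ≠ v → ¬ R v u),
        zzC R ((S ∪ T).erase v) = m.choose (S.card) * zzC R S * zzC R (T.erase v) := by
      intro v hv
      have hv := (Finset.mem_filter.1 hv).1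
      have hc := Finset.card_erase_of_mem hv
      rw [Finset.erase_union_distrib, Finset.erase_eq_of_notMem (fun h => hd' h hv),
        ih _ _ (by omega) (hd.mono_right (Finset.erase_subset _ _))
          (fun s hs t ht => hR s hs t (Finset.mem_of_mem_erase ht)), hc,
        show S.card + (T.card - 1) = m by omega]
      ring
    rw [e1, e2, Finset.sum_congr rfl s1, Finset.sum_congr rfl s2, ← Finset.mul_sum,
      ← Finset.mul_sum, ← zzC_rec R S hS, ← zzC_rec R T hT, h]
    obtain ⟨k, hk⟩ : ∃ k, S.card = k + 1 := ⟨S.card - 1, by omega⟩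
    rw [hk, Nat.choose_succ_succ]
    simp only [Nat.add_sub_cancel, Nat.succ_eq_add_one]
    ring

lemma zzC_reverse (R : ℕ → ℕ → Prop) (S : Finset ℕ) : zzC (fun x y => R y x) S = zzC R S := by
  refine Finset.card_bij' (fun l _ => l.reverse) (fun l _ => l.reverse) ?_ ?_ ?_ ?_
  · intro l h
    rw [mem_zzL] at *
    simpa [List.pairwise_reverse] using h
  · intro l h
    rw [mem_zzL] at *
    simpa [List.pairwise_reverse] using h
  · simp
  · simp

lemma zzC_shift (R : ℕ → ℕ → Prop) (a m : ℕ) :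
    zzC R (Finset.Ico a (a + m)) = zzC (fun x y => R (x + a) (y + a)) (Finset.range m) := by
  symm
  refine Finset.card_bij' (fun l _ => l.map (· + a)) (fun l _ => l.map (· - a)) ?_ ?_ ?_ ?_
  · intro l h
    rw [mem_zzL] at *
    obtain ⟨h1, h2, h3⟩ := h
    refine ⟨h1.map (add_left_injective a), fun x => ?_, by simpa [List.pairwise_map] using h3⟩
    simp only [List.mem_map, h2, Finset.mem_range, Finset.mem_Ico]
    exact ⟨fun ⟨y, hy, e⟩ => by omega, fun h => ⟨x - a, by omega, by omega⟩⟩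
  · intro l h
    rw [mem_zzL] at *
    obtain ⟨h1, h2, h3⟩ := h
    have h4 : ∀ x ∈ l, a ≤ x := fun x hx => by have := (h2 x).1 hx; simp at this; omega
    refine ⟨h1.map_on fun x hx y hy e => ?_, fun x => ?_, ?_⟩
    · have := h4 x hx
      have := h4 y hy
      omega
    · simp only [List.mem_map, h2, Finset.mem_range, Finset.mem_Ico]
      exact ⟨fun ⟨y, hy, e⟩ => by omega, fun h => ⟨x + a, by omega, by omega⟩⟩
    · rw [List.pairwise_map]
      refine h3.imp_of_mem fun hx hy h => ?_
      rwa [Nat.sub_add_cancel (h4 _ hx), Nat.sub_add_cancel (h4 _ hy)]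
  · intro l _
    simp only [List.map_map]
    conv_rhs => rw [← List.map_id l]
    exact List.map_congr_left fun x _ => by simp
  · intro l h
    rw [mem_zzL] at h
    simp only [List.map_map]
    conv_rhs => rw [← List.map_id l]
    refine List.map_congr_left fun x hx => ?_
    have := (h.2.1 x).1 hx
    simp at this ⊢
    omega

def zzR (p : ℕ) : ℕ → ℕ → Prop := fun a b => Even (a + p) ∧ (b = a + 1 ∨ b + 1 = a)

lemma zzC_parity (p : ℕ) (S : Finset ℕ) : zzC (zzR p) S = zzC (zzR 0) S := by
  rcases Nat.even_or_odd p with hp | hp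
  · congr 1
    funext a b
    simp [zzR, Nat.even_add, hp]
  · rw [← zzC_reverse]
    congr 1
    funext a b
    simp only [zzR, eq_iff_iff, Nat.even_iff] at *
    rw [Nat.odd_iff] at hp
    omega

lemma zzC_Ico (p a m : ℕ) : zzC (zzR p) (Finset.Ico a (a + m)) = zzC (zzR 0) (Finset.range m) := by
  rw [zzC_shift, ← zzC_parity (a + p)]
  congr 1
  funext x y
  simp only [zzR, eq_iff_iff, Nat.even_iff] at *
  omega

lemma zigzag_eq (n : ℕ) : zigzag n = zzC (zzR 0) (Finset.range n) := by
  rw [zigzag, digraphCounter, zzC, ← Nat.card_eq_finsetCard]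
  refine Nat.card_congr (Equiv.ofBijective
    (fun f => ⟨List.ofFn (fun i => ((f.1.symm i : Fin n) : ℕ)), ?_⟩) ⟨?_, ?_⟩)
  · rw [mem_zzL]
    refine ⟨List.nodup_ofFn.2 (Fin.val_injective.comp f.1.symm.injective), fun x => ?_, ?_⟩
    · rw [List.mem_ofFn, Finset.mem_range]
      constructor
      · rintro ⟨i, rfl⟩
        exact Fin.is_lt _
      · intro hx
        exact ⟨f.1 ⟨x, hx⟩, by simp⟩
    · rw [List.pairwise_ofFn]
      intro i j hij h
      have := f.2 (f.1.symm i) (f.1.symm j) (by simpa [zzR, staircaseArc] using h)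
      simp at this
      omega
  · intro f g h
    simp only [Subtype.mk.injEq] at h
    have h := List.ofFn_injective h
    apply Subtype.ext
    have : f.1.symm = g.1.symm := by
      ext i
      exact congrFun h i
    rw [← Equiv.symm_symm f.1, this, Equiv.symm_symm]
  · rintro ⟨l, hl⟩
    rw [mem_zzL] at hl
    obtain ⟨h1, h2, h3⟩ := hl
    have hlen : l.length = Fintype.card (Fin n) := by
      rw [← List.toFinset_card_of_nodup h1, Fintype.card_fin]
      have : l.toFinset = Finset.range n := by ext x; simp [h2]
      simp [this]
    have hb : Function.Bijective (fun i : Fin (Fintype.card (Fin n)) =>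
        (⟨l[(i : ℕ)]'(by rw [hlen]; exact i.2),
          Finset.mem_range.1 ((h2 _).1 (List.getElem_mem _))⟩ : Fin n)) := by
      rw [Fintype.bijective_iff_injective_and_card]
      refine ⟨fun i j h => ?_, by simp⟩
      simp only [Fin.mk.injEq] at h
      exact Fin.ext ((h1.getElem_inj_iff).1 h)
    refine ⟨⟨(Equiv.ofBijective _ hb).symm, ?_⟩, ?_⟩
    · intro u v huv
      obtain ⟨i, rfl⟩ := (Equiv.ofBijective _ hb).surjective u
      obtain ⟨j, rfl⟩ := (Equiv.ofBijective _ hb).surjective v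
      rw [Equiv.symm_apply_apply, Equiv.symm_apply_apply]
      by_contra hlt
      rcases (not_lt.1 hlt).lt_or_eq with hlt | he
      · refine List.pairwise_iff_getElem.1 h3 i j (by rw [hlen]; exact i.2)
          (by rw [hlen]; exact j.2) hlt ?_
        simpa [zzR, staircaseArc] using huv
      · have he := Fin.ext he
        subst he
        have := huv.2
        omega
    · apply Subtype.ext
      simp only [Equiv.symm_symm, Equiv.ofBijective_apply]
      apply List.ext_getElem
      · simp [hlen]
      · simp

lemma zz_rec (p n : ℕ) (hn : 1 ≤ n) : zigzag (n + 1) =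
    ∑ k ∈ (Finset.range (n + 1)).filter (fun k => ¬ Even (k + p)),
      n.choose k * zigzag k * zigzag (n - k) := by
  classical
  rw [zigzag_eq, ← zzC_parity p, zzC_rec _ _ (by simp)]
  refine Finset.sum_congr ?_ fun v hv => ?_
  · refine Finset.filter_congr fun v hv => ?_
    rw [Finset.mem_range] at hv
    constructor
    · intro h he
      rcases Nat.eq_zero_or_pos v with h0 | h0
      · exact h (v + 1) (Finset.mem_range.2 (by omega)) (by omega) ⟨he, Or.inl rfl⟩
      · exact h (v - 1) (Finset.mem_range.2 (by omega)) (by omega) ⟨he, Or.inr (by omega)⟩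
    · intro h u _ _ hR
      exact h hR.1
  have hv := Finset.mem_range.1 (Finset.mem_filter.1 hv).1
  have hs : (Finset.range (n + 1)).erase v = Finset.range v ∪ Finset.Ico (v + 1) (v + 1 + (n - v)) := by
    ext x
    simp only [Finset.mem_erase, Finset.mem_range, Finset.mem_union, Finset.mem_Ico]
    omega
  rw [hs, zzC_union _ _ _ _ rfl, zzC_Ico, zzC_parity, zigzag_eq, zigzag_eq]
  · simp only [Finset.card_range, Nat.card_Ico, Nat.add_sub_cancel_left]
    rw [show v + (n - v) = n by omega]
    ring
  · rw [Finset.disjoint_left]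
    intro x
    simp only [Finset.mem_range, Finset.mem_Ico]
    omega
  · intro s hs t ht
    simp only [Finset.mem_range, Finset.mem_Ico] at hs ht
    simp only [zzR]
    omega

/-- `2·s_{n+1} = ∑_{k=0}^{n} C(n,k)·s_k·s_{n−k}` for `n ≥ 1`. -/
theorem two_mul_zigzag_succ (n : ℕ) (hn : 1 ≤ n) :
    2 * zigzag (n + 1) =
      ∑ k ∈ Finset.range (n + 1), n.choose k * zigzag k * zigzag (n - k) := by
  have h0 := zz_rec 0 n hn
  have h1 := zz_rec 1 n hn
  have e : (Finset.range (n + 1)).filter (fun k => ¬ Even (k + 1))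
      = (Finset.range (n + 1)).filter (fun k => Even (k + 0)) := by
    refine Finset.filter_congr fun v _ => ?_
    simp only [Nat.even_iff]
    omega
  rw [e] at h1
  rw [← Finset.sum_filter_add_sum_filter_not (Finset.range (n + 1)) (fun k => Even (k + 0)),
    ← h0, ← h1, two_mul]
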